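/- Normalisation of critical eigenvectors and boundedness of the inverse stability operator on regular observables (Appendix B, Lemma). Let w_1, w_2 ∈ C∖R with Re w_1, Re w_2 ∈ B_κ for some fixed κ > 0, set s := −sgn(Im w_1·Im w_2), let M_1 = M(w_1), M_2 = M(w_2), and let A ∈ C^{2N×2N} be bounded. (a) If 1_δ^s(w_1,w_2) = 1 for some sufficiently small δ > 0, then the critical eigentriple (β = 1 − s·⟨M_1 E_s M_2 E_s⟩, R = M_1 E_s M_2, L = E_s) of B_{12} = 1 − M_1 S[·] M_2 satisfies ⟨L, R⟩ ∼ 1; in particular, whenever 1_δ^±(w_1,w_2) = 1, the corresponding denominator ⟨M(Re w_1 + i Im w_1) E_± M(Re w_2 ± i Im w_2) E_±⟩ in the regularisation is bounded away from zero. (b) The operator X_{12}[B] := (1 − S[M_1·B·M_2])^{-1}[B] is well defined and bounded on the s-regular component Å^s := A − 1_δ^s(w_1,w_2)·(⟨M_1 A M_2 E_s⟩/⟨M_1 E_s M_2 E_s⟩)·E_s of any bounded A, i.e. ‖X_{12}[Å^s]‖ ≲ 1. -/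

import Mathlib

open MeasureTheory Matrix Filter Topology
open scoped ComplexOrder

noncomputable section

/-- Index type for `2N × 2N` block matrices. -/
abbrev Idx (N : ℕ) := Fin N ⊕ Fin N

/-- Square `2N × 2N` complex matrices. -/
abbrev Mat2 (N : ℕ) := Matrix (Idx N) (Idx N) ℂ

/-- Normalised trace `⟨A⟩ = (dim)⁻¹ Tr A`. -/
def ntr {n : Type*} [Fintype n] (A : Matrix n n ℂ) : ℂ :=
  (Fintype.card n : ℂ)⁻¹ * A.trace

/-- The block matrix `E₋ = [[1,0],[0,-1]]`. -/
def Em (N : ℕ) : Mat2 N :=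
  Matrix.fromBlocks 1 0 0 (-1)

/-- The self-energy operator `S[T] = ⟨T E₊⟩E₊ − ⟨T E₋⟩E₋`. -/
def Sop (N : ℕ) (T : Mat2 N) : Mat2 N :=
  ntr T • (1 : Mat2 N) - ntr (T * Em N) • Em N

/-- Imaginary part of a matrix, `Im A = (A − A*)/(2i)`. -/
def matIm {n : Type*} (A : Matrix n n ℂ) : Matrix n n ℂ :=
  (2 * Complex.I)⁻¹ • (A - Aᴴ)

/-- Hermitisation `[[0, Y],[Y*, 0]]`. -/
def herm {N : ℕ} (Y : Matrix (Fin N) (Fin N) ℂ) : Mat2 N :=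
  Matrix.fromBlocks 0 Y Yᴴ 0

/-- Resolvent `(H − w)⁻¹`. -/
def resv {n : Type*} [Fintype n] [DecidableEq n]
    (H : Matrix n n ℂ) (w : ℂ) : Matrix n n ℂ :=
  (H - w • 1)⁻¹

/-- The `ℓ² → ℓ²` operator norm of a matrix. -/
def opNorm {m n : Type*} [Fintype m] [Fintype n] [DecidableEq n]
    (A : Matrix m n ℂ) : ℝ :=
  ‖LinearMap.toContinuousLinearMap (Matrix.toEuclideanLin A)‖

/-- Euclidean norm of a vector. -/
def vnorm {n : Type*} [Fintype n] (x : n → ℂ) : ℝ :=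
  Real.sqrt (∑ a, ‖x a‖ ^ 2)

/-- The law of a normalised i.i.d. matrix entry: centred, unit variance,
vanishing second moment, and all moments finite. -/
structure IsIIDLaw (μ : Measure ℂ) : Prop where
  prob : IsProbabilityMeasure μ
  moments : ∀ p : ℕ, Integrable (fun z : ℂ => ‖z‖ ^ p) μ
  mean_zero : ∫ z, z ∂μ = 0
  unit_variance : ∫ z, ‖z‖ ^ 2 ∂μ = 1
  second_moment_zero : ∫ z, z ^ 2 ∂μ = 0

/-- `X` has independent entries, each distributed as `N^{-1/2}·χ` where `χ ∼ μ`. -/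
def HasIIDEntries (N : ℕ) {Ω : Type*} [MeasureSpace Ω]
    (μ : Measure ℂ) (X : Ω → Matrix (Fin N) (Fin N) ℂ) : Prop :=
  Measure.map (fun ω => fun p : Fin N × Fin N => X ω p.1 p.2) volume
    = Measure.pi fun _ : Fin N × Fin N =>
        Measure.map (fun z : ℂ => ((((N : ℝ) ^ (-(1/2 : ℝ))) : ℝ) : ℂ) * z) μ

/-- Stochastic domination `X ≺ Y` for `N`-indexed families of random variables,
uniformly in a parameter `u : U N`. -/
def StochDom (Ω : ℕ → Type*) [∀ N, MeasureSpace (Ω N)]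
    (U : ℕ → Type*) (X Y : (N : ℕ) → U N → Ω N → ℝ) : Prop :=
  ∀ ε : ℝ, 0 < ε → ∀ D : ℝ, 0 < D → ∃ N₀ : ℕ, ∀ N : ℕ, N₀ ≤ N → ∀ u : U N,
    volume {ω : Ω N | (N : ℝ) ^ ε * Y N u ω < X N u ω}
      ≤ ENNReal.ofReal ((N : ℝ) ^ (-D))

/-- `M` solves the Matrix Dyson Equation `−M(w)⁻¹ = w − Λ̂ + S[M(w)]`
with `Im M(w)·Im w > 0`. -/
def IsMDESolution (N : ℕ) (Λ : Matrix (Fin N) (Fin N) ℂ)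
    (M : ℂ → Mat2 N) : Prop :=
  ∀ w : ℂ, w.im ≠ 0 →
    M w * (w • (1 : Mat2 N) - herm Λ + Sop N (M w)) = -1 ∧
    (w.im • matIm (M w)).PosDef

/-- The scalar self-consistent equation
`m(w) = ∫ μ_Λ̂(de)/(e − (w + m(w))) = ⟨(Λ̂ − (w+m(w)))⁻¹⟩`, `Im m·Im w > 0`. -/
def IsScalarDyson (N : ℕ) (Λ : Matrix (Fin N) (Fin N) ℂ) (m : ℂ → ℂ) : Prop :=
  ∀ w : ℂ, w.im ≠ 0 →
    m w = ntr ((herm Λ - (w + m w) • (1 : Mat2 N))⁻¹) ∧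
    0 < (m w).im * w.im
/-- Real sign function. -/
def rsgn (x : ℝ) : ℝ := if 0 < x then 1 else if x < 0 then -1 else 0

/-- `E_σ` for a sign `σ = ±1`. -/
def EOf (N : ℕ) (σ : ℝ) : Mat2 N :=
  if 0 < σ then 1 else Em N

/-- The cutoff `1_δ^σ(w,w') = φ_δ(Re w − σ Re w')·φ_δ(Im w)·φ_δ(Im w')`. -/
def cutoff (φ : ℝ → ℝ) (σ : ℝ) (w w' : ℂ) : ℝ :=
  φ (w.re - σ * w'.re) * φ w.im * φ w'.im

/-- A smooth symmetric bump function adapted to scale `δ`. -/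
structure IsBump (δ : ℝ) (φ : ℝ → ℝ) : Prop where
  smooth : ContDiff ℝ (⊤ : ℕ∞) φ
  symmetric : ∀ x, φ (-x) = φ x
  nonneg : ∀ x, 0 ≤ φ x
  le_one : ∀ x, φ x ≤ 1
  eq_one : ∀ x : ℝ, |x| ≤ δ / 2 → φ x = 1
  eq_zero : ∀ x : ℝ, δ ≤ |x| → φ x = 0

/-- One singular-component term of the regularisation (for `τ = ±1`). -/
def regTerm (N : ℕ) (M : ℂ → Mat2 N) (φ : ℝ → ℝ)
    (w w' : ℂ) (A : Mat2 N) (τ : ℝ) : Mat2 N :=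
  ((cutoff φ (τ * (-rsgn (w.im * w'.im))) w w' : ℝ) : ℂ) •
    ((ntr (M w * A * M ((w'.re : ℂ) + ((τ * w'.im : ℝ) : ℂ) * Complex.I) *
          EOf N (τ * (-rsgn (w.im * w'.im)))) /
      ntr (M w * EOf N (τ * (-rsgn (w.im * w'.im))) *
          M ((w'.re : ℂ) + ((τ * w'.im : ℝ) : ℂ) * Complex.I) *
          EOf N (τ * (-rsgn (w.im * w'.im))))) •
      EOf N (τ * (-rsgn (w.im * w'.im))))

/-- The `(w,w')`-regularisation `Å^{w,w'}` of `A`. -/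
def regularize (N : ℕ) (M : ℂ → Mat2 N) (φ : ℝ → ℝ)
    (w w' : ℂ) (A : Mat2 N) : Mat2 N :=
  A - regTerm N M φ w w' A 1 - regTerm N M φ w w' A (-1)

/-- `A` is `(w,w')`-regular. -/
def IsRegularObs (N : ℕ) (M : ℂ → Mat2 N) (φ : ℝ → ℝ)
    (w w' : ℂ) (A : Mat2 N) : Prop :=
  A = regularize N M φ w w' A
section NormalisedTrace

variable {n : Type*} [Fintype n]

lemma ntr_add (A B : Matrix n n ℂ) : ntr (A + B) = ntr A + ntr B := by
  simp [ntr, mul_add]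

lemma ntr_sub (A B : Matrix n n ℂ) : ntr (A - B) = ntr A - ntr B := by
  simp [ntr, mul_sub]

lemma ntr_neg (A : Matrix n n ℂ) : ntr (-A) = -ntr A := by
  simp [ntr]

lemma ntr_smul (c : ℂ) (A : Matrix n n ℂ) : ntr (c • A) = c * ntr A := by
  simp [ntr]; ring

lemma ntr_mul_comm (A B : Matrix n n ℂ) : ntr (A * B) = ntr (B * A) := by
  simp [ntr, Matrix.trace_mul_comm A B]

lemma ntr_conjTranspose (A : Matrix n n ℂ) : ntr Aᴴ = star (ntr A) := by
  simp [ntr, Matrix.trace_conjTranspose]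

lemma ntr_one [DecidableEq n] [Nonempty n] : ntr (1 : Matrix n n ℂ) = 1 := by
  simp [ntr]

/-- A matrix regarded as a vector of its entries. -/
def entryVec (A : Matrix n n ℂ) : EuclideanSpace ℂ (n × n) :=
  WithLp.toLp 2 fun p => A p.1 p.2

/-- The normalised Hilbert–Schmidt norm `⟨A A*⟩^{1/2}`. -/
def hs (A : Matrix n n ℂ) : ℝ :=
  √((Fintype.card n : ℝ)⁻¹) * ‖entryVec A‖

lemma hs_nonneg (A : Matrix n n ℂ) : 0 ≤ hs A := by
  unfold hs; positivity

lemma inner_entryVec (A B : Matrix n n ℂ) : inner ℂ (entryVec B) (entryVec A) = (A * Bᴴ).trace := by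
  simp only [entryVec, PiLp.inner_apply, Matrix.trace, Matrix.diag, Matrix.mul_apply,
    Matrix.conjTranspose_apply, Fintype.sum_prod_type]
  rfl

lemma ntr_mul_conjTranspose_self (A : Matrix n n ℂ) :
    ntr (A * Aᴴ) = ((hs A ^ 2 : ℝ) : ℂ) := by
  rw [ntr, ← inner_entryVec, inner_self_eq_norm_sq_to_K, hs, mul_pow, Real.sq_sqrt (by positivity)]
  push_cast
  rfl

lemma norm_ntr_mul_conjTranspose_le (A B : Matrix n n ℂ) :
    ‖ntr (A * Bᴴ)‖ ≤ hs A * hs B := by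
  have h := norm_inner_le_norm (𝕜 := ℂ) (entryVec B) (entryVec A)
  rw [ntr, ← inner_entryVec, norm_mul, hs, hs]
  have h2 : ‖(Fintype.card n : ℂ)⁻¹‖ = √((Fintype.card n : ℝ)⁻¹) * √((Fintype.card n : ℝ)⁻¹) := by
    rw [Real.mul_self_sqrt (by positivity)]; simp
  rw [h2]
  calc _ ≤ √((Fintype.card n : ℝ)⁻¹) * √((Fintype.card n : ℝ)⁻¹) * (‖entryVec B‖ * ‖entryVec A‖) := by
        gcongr
    _ = _ := by ring

lemma hs_conjTranspose (A : Matrix n n ℂ) : hs Aᴴ = hs A := by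
  have h1 := ntr_mul_conjTranspose_self A
  have h2 := ntr_mul_conjTranspose_self Aᴴ
  rw [Matrix.conjTranspose_conjTranspose, ntr_mul_comm, h1] at h2
  exact (pow_left_inj₀ (hs_nonneg _) (hs_nonneg _) two_ne_zero).1 (by exact_mod_cast h2.symm)

lemma norm_ntr_mul_le (A B : Matrix n n ℂ) : ‖ntr (A * B)‖ ≤ hs A * hs B := by
  simpa [hs_conjTranspose] using norm_ntr_mul_conjTranspose_le A Bᴴ

lemma hs_sub_le (A B : Matrix n n ℂ) : hs (A - B) ≤ hs A + hs B := by
  have : entryVec (A - B) = entryVec A - entryVec B := rfl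
  rw [hs, hs, hs, this, ← mul_add]
  gcongr
  exact norm_sub_le _ _

lemma hs_smul (c : ℂ) (A : Matrix n n ℂ) : hs (c • A) = ‖c‖ * hs A := by
  have : entryVec (c • A) = c • entryVec A := rfl
  rw [hs, hs, this, norm_smul]; ring

lemma hs_one_le [DecidableEq n] : hs (1 : Matrix n n ℂ) ≤ 1 := by
  have h := ntr_mul_conjTranspose_self (1 : Matrix n n ℂ)
  have h3 : hs (1 : Matrix n n ℂ) ^ 2 ≤ 1 := by
    rcases isEmpty_or_nonempty n with hn | hn
    · simp [hs]
    · simp only [Matrix.conjTranspose_one, mul_one, ntr_one] at h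
      exact_mod_cast h.ge
  exact (sq_le_one_iff₀ (hs_nonneg _)).1 h3

lemma norm_ntr_le [DecidableEq n] (A : Matrix n n ℂ) : ‖ntr A‖ ≤ hs A := by
  have h := norm_ntr_mul_le A 1
  rw [mul_one] at h
  exact h.trans (mul_le_of_le_one_right (hs_nonneg _) hs_one_le)

lemma hs_sub_conjTranspose_sq (A B : Matrix n n ℂ) :
    hs (A - Bᴴ) ^ 2 = hs A ^ 2 + hs B ^ 2 - 2 * (ntr (A * B)).re := by
  have h := ntr_mul_conjTranspose_self (A - Bᴴ)
  have h2 : (A - Bᴴ) * (A - Bᴴ)ᴴ = A * Aᴴ + Bᴴ * B - (A * B + (A * B)ᴴ) := by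
    simp only [Matrix.conjTranspose_sub, Matrix.conjTranspose_conjTranspose,
      Matrix.conjTranspose_mul]
    noncomm_ring
  rw [h2, ntr_sub, ntr_add, ntr_add, ntr_conjTranspose, ntr_mul_comm Bᴴ,
    ntr_mul_conjTranspose_self, ntr_mul_conjTranspose_self] at h
  have h3 := congrArg Complex.re h
  simp only [Complex.sub_re, Complex.add_re, Complex.ofReal_re, Complex.star_def,
    Complex.conj_re] at h3
  linarith

lemma hs_mul_le [DecidableEq n] (A X : Matrix n n ℂ) : hs (A * X) ≤ opNorm A * hs X := by
  have key : ‖entryVec (A * X)‖ ≤ opNorm A * ‖entryVec X‖ := by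
    have hn : ∀ Y : Matrix n n ℂ,
        ‖entryVec Y‖ ^ 2 = ∑ j, ‖(WithLp.toLp 2 (Y.col j) : EuclideanSpace ℂ n)‖ ^ 2 := by
      intro Y
      simp only [EuclideanSpace.norm_sq_eq, entryVec, Fintype.sum_prod_type]
      rw [Finset.sum_comm]
      rfl
    have h0 : 0 ≤ opNorm A := norm_nonneg _
    refine (sq_le_sq₀ (norm_nonneg _) (by positivity)).1 ?_
    rw [mul_pow, hn, hn, Finset.mul_sum]
    refine Finset.sum_le_sum fun j _ => ?_
    rw [← mul_pow]
    refine pow_le_pow_left₀ (norm_nonneg _) ?_ 2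
    exact (LinearMap.toContinuousLinearMap (Matrix.toEuclideanLin A)).le_opNorm
      (WithLp.toLp 2 (X.col j))
  unfold hs
  calc _ ≤ √((Fintype.card n : ℝ)⁻¹) * (opNorm A * ‖entryVec X‖) := by gcongr
    _ = _ := by ring

end NormalisedTrace

section OpNorm
variable {n : Type*} [Fintype n] [DecidableEq n]

lemma opNorm_add_le (A B : Matrix n n ℂ) : opNorm (A + B) ≤ opNorm A + opNorm B := by
  simp only [opNorm, map_add]
  exact norm_add_le _ _

lemma opNorm_smul (c : ℂ) (A : Matrix n n ℂ) : opNorm (c • A) = ‖c‖ * opNorm A := by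
  simp only [opNorm, map_smul, norm_smul]

open scoped Matrix.Norms.L2Operator in
lemma opNorm_le_one_of_mem_unitary {U : Matrix n n ℂ} (hU : U ∈ unitary (Matrix n n ℂ)) :
    opNorm U ≤ 1 := by
  have : opNorm U = ‖U‖ := rfl
  rw [this]
  rcases isEmpty_or_nonempty n with hn | hn
  · rw [Subsingleton.elim U 0]; simp
  · exact (CStarRing.norm_of_mem_unitary hU).le
end OpNorm

/-- `G` is the resolvent of `H` at `w + ⟨G⟩`, with `Im ⟨G⟩ · Im w > 0`. -/
structure IsDyson {n : Type*} [Fintype n] [DecidableEq n]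
    (H : Matrix n n ℂ) (w : ℂ) (G : Matrix n n ℂ) : Prop where
  mul_eq_one : G * (H - (w + ntr G) • (1 : Matrix n n ℂ)) = 1
  im_mul_pos : 0 < (ntr G).im * w.im

namespace IsDyson

variable {n : Type*} [Fintype n] [DecidableEq n] {H G G₁ G₂ : Matrix n n ℂ} {w w₁ w₂ : ℂ}

lemma mul_eq_one' (h : IsDyson H w G) : (H - (w + ntr G) • (1 : Matrix n n ℂ)) * G = 1 :=
  mul_eq_one_comm.1 h.mul_eq_one

lemma abs_im_pos (h : IsDyson H w G) : 0 < |w.im| :=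
  abs_pos.2 (right_ne_zero_of_mul h.im_mul_pos.ne')

lemma abs_im_ntr_pos (h : IsDyson H w G) : 0 < |(ntr G).im| :=
  abs_pos.2 (left_ne_zero_of_mul h.im_mul_pos.ne')

lemma abs_im_add (h : IsDyson H w G) : |(w + ntr G).im| = |w.im| + |(ntr G).im| := by
  rw [Complex.add_im]
  rcases mul_pos_iff.1 h.im_mul_pos with ⟨h1, h2⟩ | ⟨h1, h2⟩
  · rw [abs_of_pos h1, abs_of_pos h2, abs_of_pos (by positivity)]
  · rw [abs_of_neg h1, abs_of_neg h2, abs_of_neg (by linarith)]; ring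

protected lemma conjTranspose (h : IsDyson H w G) (hH : Hᴴ = H) : IsDyson H (star w) Gᴴ := by
  refine ⟨?_, ?_⟩
  · have := congrArg Matrix.conjTranspose h.mul_eq_one'
    simpa [Matrix.conjTranspose_mul, Matrix.conjTranspose_sub, Matrix.conjTranspose_smul, hH,
      ntr_conjTranspose] using this
  · rw [ntr_conjTranspose]
    simpa using h.im_mul_pos

/-- The resolvent identity. -/
lemma sub_eq (h₁ : IsDyson H w₁ G₁) (h₂ : IsDyson H w₂ G₂) :
    G₁ - G₂ = ((w₁ + ntr G₁) - (w₂ + ntr G₂)) • (G₁ * G₂) := by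
  have e : ((w₁ + ntr G₁) - (w₂ + ntr G₂)) • (1 : Matrix n n ℂ) =
      (H - (w₂ + ntr G₂) • (1 : Matrix n n ℂ)) - (H - (w₁ + ntr G₁) • (1 : Matrix n n ℂ)) := by
    rw [sub_smul]; abel
  calc G₁ - G₂ = G₁ * ((H - (w₂ + ntr G₂) • (1 : Matrix n n ℂ)) * G₂)
        - (G₁ * (H - (w₁ + ntr G₁) • (1 : Matrix n n ℂ))) * G₂ := by
        rw [h₁.mul_eq_one, h₂.mul_eq_one', mul_one, one_mul]
    _ = G₁ * (((w₁ + ntr G₁) - (w₂ + ntr G₂)) • (1 : Matrix n n ℂ)) * G₂ := by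
        rw [e]; noncomm_ring
    _ = _ := by simp

lemma sub_mul_one_sub (h₁ : IsDyson H w₁ G₁) (h₂ : IsDyson H w₂ G₂) :
    ((w₁ + ntr G₁) - (w₂ + ntr G₂)) * (1 - ntr (G₁ * G₂)) = w₁ - w₂ := by
  have h := congrArg ntr (h₁.sub_eq h₂)
  rw [ntr_sub, ntr_smul] at h
  linear_combination h

/-- The Ward identity. -/
lemma hs_sq_mul (h : IsDyson H w G) (hH : Hᴴ = H) :
    hs G ^ 2 * (|w.im| + |(ntr G).im|) = |(ntr G).im| := by
  have e := congrArg ntr (h.sub_eq (h.conjTranspose hH))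
  rw [ntr_sub, ntr_smul, ntr_mul_conjTranspose_self, ntr_conjTranspose] at e
  have e2 := congrArg Complex.im e
  simp only [Complex.sub_im, Complex.star_def, Complex.conj_im, Complex.mul_im,
    Complex.ofReal_im, Complex.ofReal_re, Complex.add_im] at e2
  have e3 : (ntr G).im = hs G ^ 2 * (w.im + (ntr G).im) := by linarith
  rw [← h.abs_im_add]
  conv_rhs => rw [e3, abs_mul, abs_of_nonneg (sq_nonneg _)]
  rw [Complex.add_im]

lemma hs_sq_lt_one (h : IsDyson H w G) (hH : Hᴴ = H) : hs G ^ 2 < 1 := by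
  have := h.hs_sq_mul hH
  have h1 := h.abs_im_pos
  have h2 := h.abs_im_ntr_pos
  by_contra! hc
  nlinarith

lemma hs_le_one (h : IsDyson H w G) (hH : Hᴴ = H) : hs G ≤ 1 :=
  (sq_le_one_iff₀ (hs_nonneg _)).1 (h.hs_sq_lt_one hH).le

lemma norm_ntr_mul_le_one (h₁ : IsDyson H w₁ G₁) (h₂ : IsDyson H w₂ G₂) (hH : Hᴴ = H) :
    ‖ntr (G₁ * G₂)‖ ≤ 1 :=
  (norm_ntr_mul_le _ _).trans
    (mul_le_one₀ (h₁.hs_le_one hH) (hs_nonneg _) (h₂.hs_le_one hH))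

lemma hs_sq_le_of_le_im (h : IsDyson H w G) (hH : Hᴴ = H) {x : ℝ} (hx : 0 ≤ x) (hx1 : x ≤ 1)
    (hxw : x ≤ |w.im|) : hs G ^ 2 ≤ 1 - x / 2 := by
  have e := h.hs_sq_mul hH
  have h1 : |(ntr G).im| ≤ 1 :=
    (Complex.abs_im_le_norm _).trans ((norm_ntr_le _).trans (h.hs_le_one hH))
  have h2 := h.abs_im_ntr_pos
  have h3 := h.abs_im_pos
  by_contra! hc
  have h4 : (1 - x / 2) * (|w.im| + |(ntr G).im|) < |(ntr G).im| := by
    conv_rhs => rw [← e]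
    gcongr
  nlinarith [mul_nonneg hx (sub_nonneg.2 hxw)]

lemma half_sq_le (h₁ : IsDyson H w₁ G₁) (h₂ : IsDyson H w₂ G₂) (hH : Hᴴ = H)
    (hw : 0 < w₁.im * w₂.im) : (ntr G₁).im ^ 2 / 2 ≤ ‖1 - ntr (G₁ * G₂)‖ := by
  have e := hs_sub_conjTranspose_sq G₁ G₂
  have a1 := h₁.hs_sq_lt_one hH
  have a2 := h₂.hs_sq_lt_one hH
  have hm : 0 ≤ (ntr G₁).im * (ntr G₂).im := by
    have := mul_pos h₁.im_mul_pos h₂.im_mul_pos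
    by_contra! hc
    nlinarith
  have b : |(ntr G₁).im + (ntr G₂).im| ≤ hs (G₁ - G₂ᴴ) := by
    refine le_trans ?_ (norm_ntr_le _)
    refine le_trans (le_of_eq ?_) (Complex.abs_im_le_norm _)
    simp [ntr_sub, ntr_conjTranspose]
  have b2 : ((ntr G₁).im + (ntr G₂).im) ^ 2 ≤ hs (G₁ - G₂ᴴ) ^ 2 := by
    rw [← sq_abs]; gcongr
  have c : 1 - (ntr (G₁ * G₂)).re ≤ ‖1 - ntr (G₁ * G₂)‖ := by
    simpa using Complex.re_le_norm (1 - ntr (G₁ * G₂))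
  nlinarith [sq_nonneg (ntr G₂).im]

/-- The resolvent is bounded by the inverse distance to the real axis. -/
lemma abs_im_mul_hs_le (h : IsDyson H w G) (hH : Hᴴ = H) (X : Matrix n n ℂ) :
    |(w + ntr G).im| * hs (G * X) ≤ hs X := by
  set u := w + ntr G with hu
  set Y := G * X
  have hX : X = (H - u • (1 : Matrix n n ℂ)) * Y := by
    rw [← mul_assoc, h.mul_eq_one', one_mul]
  have e := ntr_mul_conjTranspose_self X
  set Z := (H - (u.re : ℂ) • (1 : Matrix n n ℂ)) * Y with hZ
  have hX2 : X = Z - ((u.im : ℂ) * Complex.I) • Y := by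
    rw [hX, hZ, sub_mul, sub_mul, sub_sub]
    congr 1
    simp only [Algebra.smul_mul_assoc, one_mul, ← add_smul, Complex.re_add_im]
  have hself : star (ntr (Z * Yᴴ)) = ntr (Z * Yᴴ) := by
    rw [← ntr_conjTranspose, Matrix.conjTranspose_mul, Matrix.conjTranspose_conjTranspose, hZ,
      Matrix.conjTranspose_mul, Matrix.conjTranspose_sub, hH, Matrix.conjTranspose_smul,
      ← mul_assoc, ntr_mul_comm, ← mul_assoc]
    simp [ntr_mul_comm, mul_assoc]
  have hre : (ntr (Z * (((u.im : ℂ) * Complex.I) • Y)ᴴ)).re = 0 := by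
    rw [Matrix.conjTranspose_smul, Matrix.mul_smul, ntr_smul]
    have : (ntr (Z * Yᴴ)).im = 0 := Complex.conj_eq_iff_im.1 hself
    simp [this]
  have e2 := hs_sub_conjTranspose_sq Z (((u.im : ℂ) * Complex.I) • Y)ᴴ
  rw [hre, Matrix.conjTranspose_conjTranspose, ← hX2, hs_conjTranspose, hs_smul] at e2
  have e3 : ‖(u.im : ℂ) * Complex.I‖ = |u.im| := by simp
  rw [e3] at e2
  refine (sq_le_sq₀ (mul_nonneg (abs_nonneg _) (hs_nonneg _)) (hs_nonneg _)).1 ?_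
  nlinarith [sq_nonneg (hs Z)]

lemma hs_sq_le_hs_mul_self (h : IsDyson H w G) (hH : Hᴴ = H) : hs G ^ 2 ≤ hs (G * G) := by
  have hc : G * Gᴴ = Gᴴ * G := by
    have e1 := h.sub_eq (h.conjTranspose hH)
    have e2 := (h.conjTranspose hH).sub_eq h
    set u := w + ntr G - (star w + ntr Gᴴ) with hu
    have e3 : u • (G * Gᴴ - Gᴴ * G) = 0 := by
      have : star w + ntr Gᴴ - (w + ntr G) = -u := by rw [hu]; ring
      rw [this] at e2
      have e4 : G - Gᴴ = u • (Gᴴ * G) := by rw [← neg_sub, e2, neg_smul, neg_neg]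
      rw [smul_sub, ← e1, ← e4, sub_self]
    refine sub_eq_zero.1 ((smul_eq_zero.1 e3).resolve_left fun h0 => ?_)
    have h1 := congrArg Complex.im h0
    rw [hu, ntr_conjTranspose] at h1
    simp only [Complex.sub_im, Complex.add_im, Complex.star_def, Complex.conj_im,
      Complex.zero_im] at h1
    have h2 := h.abs_im_add
    rw [Complex.add_im, show w.im + (ntr G).im = 0 by linarith, abs_zero] at h2
    linarith [h.abs_im_pos, h.abs_im_ntr_pos]
  have e : hs (G * G) = hs (G * Gᴴ) := by
    have e1 := ntr_mul_conjTranspose_self (G * G)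
    have e2 := ntr_mul_conjTranspose_self (G * Gᴴ)
    have e3 : G * G * (G * G)ᴴ = G * Gᴴ * (G * Gᴴ)ᴴ := by
      simp only [Matrix.conjTranspose_mul, Matrix.conjTranspose_conjTranspose]
      calc G * G * (Gᴴ * Gᴴ) = G * (G * Gᴴ) * Gᴴ := by noncomm_ring
        _ = G * (Gᴴ * G) * Gᴴ := by rw [hc]
        _ = _ := by noncomm_ring
    rw [e3, e2] at e1
    exact (pow_left_inj₀ (hs_nonneg _) (hs_nonneg _) two_ne_zero).1 (by exact_mod_cast e1.symm)
  rw [e]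
  have := norm_ntr_le (G * Gᴴ)
  rw [ntr_mul_conjTranspose_self, Complex.norm_real, Real.norm_of_nonneg (sq_nonneg _)] at this
  exact this

end IsDyson

/-- A Dyson solution which is macroscopically away from the real axis in `w` or in `⟨G⟩`. -/
structure IsBulkDyson {n : Type*} [Fintype n] [DecidableEq n] (q : ℝ)
    (H : Matrix n n ℂ) (w : ℂ) (G : Matrix n n ℂ) : Prop extends IsDyson H w G where
  le_abs_im : q ≤ |w.im| ∨ q ≤ |(ntr G).im|

namespace IsBulkDyson

variable {n : Type*} [Fintype n] [DecidableEq n] {H G G₁ G₂ : Matrix n n ℂ} {w w₁ w₂ : ℂ} {q : ℝ}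

protected lemma conjTranspose (h : IsBulkDyson q H w G) (hH : Hᴴ = H) :
    IsBulkDyson q H (star w) Gᴴ := by
  refine ⟨h.toIsDyson.conjTranspose hH, ?_⟩
  simpa [ntr_conjTranspose] using h.le_abs_im

lemma le_abs_im_add (h : IsBulkDyson q H w G) : q ≤ |(w + ntr G).im| := by
  rw [h.toIsDyson.abs_im_add]
  rcases h.le_abs_im with h1 | h1
  · linarith [abs_nonneg (ntr G).im]
  · linarith [abs_nonneg w.im]

/-- The stability factor is bounded below within one half-plane. -/
lemma le_norm_one_sub_of_im_mul_pos (h₁ : IsBulkDyson q H w₁ G₁) (h₂ : IsDyson H w₂ G₂)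
    (hH : Hᴴ = H) (hq : 0 < q) (hq1 : q ≤ 1) (hw : 0 < w₁.im * w₂.im) :
    q ^ 2 / 4 ≤ ‖1 - ntr (G₁ * G₂)‖ := by
  rcases h₁.le_abs_im with h | h
  · have e := hs_sub_conjTranspose_sq G₁ G₂
    have a1 := h₁.toIsDyson.hs_sq_le_of_le_im hH hq.le hq1 h
    have a2 := h₂.hs_sq_lt_one hH
    have c : 1 - (ntr (G₁ * G₂)).re ≤ ‖1 - ntr (G₁ * G₂)‖ := by
      simpa using Complex.re_le_norm (1 - ntr (G₁ * G₂))
    nlinarith [sq_nonneg (hs (G₁ - G₂ᴴ))]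
  · have := h₁.toIsDyson.half_sq_le h₂ hH hw
    have h2 : q ^ 2 ≤ (ntr G₁).im ^ 2 := by
      rw [← sq_abs (ntr G₁).im]; gcongr
    nlinarith

lemma mul_hs_le (h : IsBulkDyson q H w G) (hH : Hᴴ = H) (X : Matrix n n ℂ) :
    q * hs (G * X) ≤ hs X :=
  (mul_le_mul_of_nonneg_right h.le_abs_im_add (hs_nonneg _)).trans
    (h.toIsDyson.abs_im_mul_hs_le hH X)

/-- For nearby spectral parameters close to the real axis, `⟨G₁ G₂*⟩` is close to one. -/
lemma norm_one_sub_le_half (h₁ : IsBulkDyson q H w₁ G₁) (h₂ : IsBulkDyson q H w₂ G₂)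
    (hH : Hᴴ = H) (hq : 0 < q) (hq1 : q ≤ 1) (hw : 0 < w₁.im * w₂.im) {δ : ℝ}
    (hδ : δ ≤ q ^ 3 / 26) (hd : |w₁.im| ≤ δ) (hd' : ‖w₁ - w₂‖ ≤ 3 * δ) :
    ‖1 - ntr (G₁ * G₂ᴴ)‖ ≤ 1 / 2 := by
  have hD : hs (G₁ - G₂) * q ^ 3 ≤ 12 * δ := by
    have e := h₁.toIsDyson.sub_eq h₂.toIsDyson
    have e1 := h₁.toIsDyson.sub_mul_one_sub h₂.toIsDyson
    have e2 := congrArg norm e1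
    rw [norm_mul] at e2
    set U := ‖(w₁ + ntr G₁) - (w₂ + ntr G₂)‖ with hU
    have b := h₁.le_norm_one_sub_of_im_mul_pos h₂.toIsDyson hH hq hq1 hw
    have hU0 : 0 ≤ U := norm_nonneg _
    have b1 : U * (q ^ 2 / 4) ≤ 3 * δ := by
      calc U * (q ^ 2 / 4) ≤ U * ‖1 - ntr (G₁ * G₂)‖ := by gcongr
        _ ≤ 3 * δ := e2.trans_le hd'
    have e3 : hs (G₁ - G₂) = U * hs (G₁ * G₂) := by rw [e, hs_smul]
    have b2 : q * hs (G₁ * G₂) ≤ 1 := (h₁.mul_hs_le hH G₂).trans (h₂.toIsDyson.hs_le_one hH)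
    calc hs (G₁ - G₂) * q ^ 3 = (U * q ^ 2) * (q * hs (G₁ * G₂)) := by rw [e3]; ring
      _ ≤ (U * q ^ 2) * 1 := by gcongr
      _ ≤ _ := by linarith
  have hθ : (1 - hs G₁ ^ 2) * q ≤ δ := by
    have e := h₁.toIsDyson.hs_sq_mul hH
    have e1 := h₁.le_abs_im_add
    rw [h₁.toIsDyson.abs_im_add] at e1
    have e2 := h₁.toIsDyson.hs_sq_lt_one hH
    nlinarith
  have hs1 := h₁.toIsDyson.hs_sq_lt_one hH
  have e : 1 - ntr (G₁ * G₂ᴴ) =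
      ((1 - hs G₁ ^ 2 : ℝ) : ℂ) + ntr (G₁ * (G₁ - G₂)ᴴ) := by
    rw [Matrix.conjTranspose_sub, mul_sub, ntr_sub, ntr_mul_conjTranspose_self]
    push_cast; ring
  have hb : ‖1 - ntr (G₁ * G₂ᴴ)‖ ≤ (1 - hs G₁ ^ 2) + hs (G₁ - G₂) := by
    rw [e]
    refine (norm_add_le _ _).trans (add_le_add ?_ ?_)
    · rw [Complex.norm_real, Real.norm_of_nonneg (by linarith)]
    · refine (norm_ntr_mul_conjTranspose_le _ _).trans ?_
      exact mul_le_of_le_one_left (hs_nonneg _) (h₁.toIsDyson.hs_le_one hH)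
  have hq3 : 0 < q ^ 3 := by positivity
  have hx : (1 - hs G₁ ^ 2) * q ^ 3 ≤ δ := by
    have : q ^ 3 ≤ q := by nlinarith [mul_nonneg hq.le (sub_nonneg.2 hq1), sq_nonneg q]
    nlinarith
  have : ((1 - hs G₁ ^ 2) + hs (G₁ - G₂)) * q ^ 3 ≤ 1 / 2 * q ^ 3 := by nlinarith
  exact hb.trans (le_of_mul_le_mul_right this hq3)

/-- Away from the critical regime the factor `1 - ⟨G₁ G₂*⟩` is bounded below. -/
lemma le_norm_one_sub_conjTranspose (h₁ : IsBulkDyson q H w₁ G₁) (h₂ : IsDyson H w₂ G₂)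
    (hH : Hᴴ = H) (hq : 0 < q) (hq1 : q ≤ 1) {x : ℝ} (hx : 0 < x) (hx1 : x ≤ 1)
    (hd : x ≤ |w₁.im| ∨ x ≤ |w₂.im| ∨ x ≤ ‖w₁ - w₂‖) :
    x ^ 2 * q ^ 2 / 72 ≤ ‖1 - ntr (G₁ * G₂ᴴ)‖ := by
  have c : 1 - (ntr (G₁ * G₂ᴴ)).re ≤ ‖1 - ntr (G₁ * G₂ᴴ)‖ := by
    simpa using Complex.re_le_norm (1 - ntr (G₁ * G₂ᴴ))
  have e := hs_sub_conjTranspose_sq G₁ G₂ᴴ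
  rw [Matrix.conjTranspose_conjTranspose, hs_conjTranspose] at e
  have a1 := h₁.toIsDyson.hs_sq_lt_one hH
  have a2 := h₂.hs_sq_lt_one hH
  have hsm : x ^ 2 * q ^ 2 ≤ x := by
    calc x ^ 2 * q ^ 2 ≤ x * 1 := by
          gcongr
          · nlinarith
          · nlinarith
      _ = x := mul_one x
  rcases hd with hd | hd | hd
  · have := h₁.toIsDyson.hs_sq_le_of_le_im hH hx.le hx1 hd
    nlinarith [sq_nonneg (hs (G₁ - G₂))]
  · have := h₂.hs_sq_le_of_le_im hH hx.le hx1 hd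
    nlinarith [sq_nonneg (hs (G₁ - G₂))]
  · by_cases h12 : hs G₁ ^ 2 ≤ 1 / 2
    · nlinarith [sq_nonneg (hs (G₁ - G₂))]
    push Not at h12
    have e1 := h₁.toIsDyson.sub_eq h₂
    have e2 := congrArg norm (h₁.toIsDyson.sub_mul_one_sub h₂)
    rw [norm_mul] at e2
    set U := ‖(w₁ + ntr G₁) - (w₂ + ntr G₂)‖ with hU
    have hU0 : 0 ≤ U := norm_nonneg _
    have b0 : ‖1 - ntr (G₁ * G₂)‖ ≤ 2 := by
      refine (norm_sub_le _ _).trans ?_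
      have := h₁.toIsDyson.norm_ntr_mul_le_one h₂ hH
      rw [norm_one]; linarith
    have b1 : x / 2 ≤ U := by nlinarith
    have e3 : hs (G₁ - G₂) = U * hs (G₁ * G₂) := by rw [e1, hs_smul]
    set D := hs (G₁ - G₂) with hDdef
    have hD0 : 0 ≤ D := hs_nonneg _
    have b2 : hs G₁ ^ 2 ≤ hs (G₁ * G₂) + hs (G₁ * (G₁ - G₂)) := by
      refine (h₁.toIsDyson.hs_sq_le_hs_mul_self hH).trans ?_
      have e4 : G₁ * G₁ = G₁ * (G₁ - G₂) - (-1 : ℂ) • (G₁ * G₂) := by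
        simp [mul_sub]
      rw [e4]
      refine (hs_sub_le _ _).trans (le_of_eq ?_)
      rw [hs_smul]; simp [add_comm]
    have b3 : q * hs (G₁ * (G₁ - G₂)) ≤ D := h₁.mul_hs_le hH _
    have b4 : (x / 2) * hs (G₁ * G₂) ≤ D := by
      rw [e3]; exact mul_le_mul_of_nonneg_right b1 (hs_nonneg _)
    have b5 : x * q / 6 ≤ D := by
      have k1 : q / 2 ≤ q * hs (G₁ * G₂) + D := by nlinarith
      have k2 : x / 2 * (q / 2) ≤ q * D + x / 2 * D := by nlinarith
      have k3 : q * D + x / 2 * D ≤ 3 / 2 * D := by nlinarith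
      nlinarith
    have b6 : (x * q / 6) ^ 2 ≤ D ^ 2 := by gcongr
    nlinarith

end IsBulkDyson

lemma IsDyson.one_sub_ntr_mul_ne_zero {n : Type*} [Fintype n] [DecidableEq n]
    {H G₁ G₂ : Matrix n n ℂ} {w₁ w₂ : ℂ} (h₁ : IsDyson H w₁ G₁) (h₂ : IsDyson H w₂ G₂)
    (hH : Hᴴ = H) : 1 - ntr (G₁ * G₂) ≠ 0 := by
  intro h
  have h' := norm_ntr_mul_le G₁ G₂
  rw [← sub_eq_zero.1 h, norm_one] at h'
  have a1 := h₁.hs_sq_lt_one hH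
  have a2 := h₂.hs_sq_lt_one hH
  nlinarith [sq_nonneg (hs G₁ - hs G₂)]

/-- A positive boundary density at `Re w` keeps the solution at `w` away from the real axis. -/
lemma isBulkDyson_of_tendsto {n : Type*} [Fintype n] [DecidableEq n]
    {H G : Matrix n n ℂ} {w b : ℂ} {r : ℝ} (hH : Hᴴ = H) (h : IsDyson H w G) (hw : 0 < w.im)
    (hr : 0 < r) (hr1 : r ≤ 1) {F : ℝ → Matrix n n ℂ}
    (hF : ∀ η : ℝ, 0 < η → IsDyson H ((w.re : ℂ) + (η : ℂ) * Complex.I) (F η))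
    (hb : Tendsto (fun η => ntr (F η)) (𝓝[>] 0) (𝓝 b)) (hrb : r ≤ b.im) :
    IsBulkDyson (r ^ 3 / 8) H w G := by
  refine ⟨h, ?_⟩
  by_contra! hc
  obtain ⟨hc1, hc2⟩ := hc
  rw [abs_of_pos hw] at hc1
  have hm : 0 < (ntr G).im := (pos_iff_pos_of_mul_pos h.im_mul_pos).2 hw
  rw [abs_of_pos hm] at hc2
  have hη : Tendsto (fun η : ℝ => (w.re : ℂ) + (η : ℂ) * Complex.I) (𝓝[>] 0) (𝓝 (w.re : ℂ)) := by
    have : Continuous fun η : ℝ => (w.re : ℂ) + (η : ℂ) * Complex.I := by fun_prop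
    simpa using (this.tendsto 0).mono_left nhdsWithin_le_nhds
  have key : b.im ^ 2 / 2 * ‖(w.re + b) - (w + ntr G)‖ ≤ ‖(w.re : ℂ) - w‖ := by
    refine le_of_tendsto_of_tendsto
      ((((Complex.continuous_im.tendsto b).comp hb).pow 2 |>.div_const 2).mul
        ((hη.add hb).sub_const _).norm) (hη.sub_const w).norm ?_
    filter_upwards [self_mem_nhdsWithin] with η (hη0 : 0 < η)
    have e := congrArg norm ((hF η hη0).sub_mul_one_sub h)
    rw [norm_mul, mul_comm] at e
    rw [← e]
    refine mul_le_mul_of_nonneg_right ?_ (norm_nonneg _)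
    exact (hF η hη0).half_sq_le h hH (by simpa using mul_pos hη0 hw)
  have k1 : ‖(w.re : ℂ) - w‖ = w.im := by
    have : (w.re : ℂ) - w = -((w.im : ℂ) * Complex.I) := by
      linear_combination Complex.re_add_im w
    rw [this]; simp [abs_of_pos hw]
  have k2 : b.im - (w.im + (ntr G).im) ≤ ‖(w.re + b) - (w + ntr G)‖ := by
    refine le_trans (le_of_eq ?_) (Complex.im_le_norm _)
    simp
  rw [k1] at key
  have hr2 : r ^ 2 ≤ b.im ^ 2 := by gcongr
  have hN := norm_nonneg ((w.re + b) - (w + ntr G))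
  have k3 : r ^ 2 / 2 * (b.im - (w.im + (ntr G).im)) ≤ w.im := by
    refine le_trans ?_ key
    calc _ ≤ r ^ 2 / 2 * ‖(w.re + b) - (w + ntr G)‖ := by gcongr
      _ ≤ _ := by gcongr
  have hr3 : r ^ 3 ≤ r := by nlinarith [mul_nonneg hr.le (sub_nonneg.2 hr1), sq_nonneg r]
  have k4 : r * (3 / 4) ≤ b.im - (w.im + (ntr G).im) := by linarith
  have : r ^ 2 / 2 * (r * (3 / 4)) ≤ w.im := le_trans (by gcongr) k3
  nlinarith [pow_pos hr 3]

section Chirality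

variable {N : ℕ}

lemma Em_mul_Em : Em N * Em N = 1 := by
  simp [Em, Matrix.fromBlocks_multiply]

lemma Em_conjTranspose : (Em N)ᴴ = Em N := by
  simp [Em, Matrix.fromBlocks_conjTranspose]

lemma herm_conjTranspose (Y : Matrix (Fin N) (Fin N) ℂ) : (herm Y)ᴴ = herm Y := by
  simp [herm, Matrix.fromBlocks_conjTranspose]

lemma Em_mul_herm (Y : Matrix (Fin N) (Fin N) ℂ) : Em N * herm Y = -(herm Y * Em N) := by
  simp [Em, herm, Matrix.fromBlocks_multiply, Matrix.fromBlocks_neg]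

lemma ntr_Em : ntr (Em N) = 0 := by
  simp [ntr, Em, Matrix.trace, Fintype.sum_sum_type]

lemma opNorm_Em_le : opNorm (Em N) ≤ 1 :=
  opNorm_le_one_of_mem_unitary (by
    rw [Unitary.mem_iff, Matrix.star_eq_conjTranspose, Em_conjTranspose]
    exact ⟨Em_mul_Em, Em_mul_Em⟩)

lemma ntr_Em_mul_herm_mul_add (Y : Matrix (Fin N) (Fin N) ℂ) (Q : Mat2 N) :
    ntr (Em N * (herm Y * Q)) + ntr (Em N * (Q * herm Y)) = 0 := by
  have h : ntr (Em N * (Q * herm Y)) = ntr (herm Y * Em N * Q) := by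
    rw [← mul_assoc, ntr_mul_comm, mul_assoc]
  rw [h, ← ntr_add, ← mul_assoc, ← add_mul, Em_mul_herm]
  simp [ntr]

/-- The off-diagonal part of the self-energy vanishes on solutions. -/
lemma ntr_mul_Em_eq_zero {Y : Matrix (Fin N) (Fin N) ℂ} {w : ℂ} {G : Mat2 N} (hw : w ≠ 0)
    (h : G * (w • (1 : Mat2 N) - herm Y + Sop N G) = -1) : ntr (G * Em N) = 0 := by
  have h' : (w • (1 : Mat2 N) - herm Y + Sop N G) * G = -1 := by
    have : G * -(w • (1 : Mat2 N) - herm Y + Sop N G) = 1 := by rw [mul_neg, h, neg_neg]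
    have := mul_eq_one_comm.1 this
    rw [neg_mul] at this
    exact neg_eq_iff_eq_neg.1 this
  have e1 := congrArg (fun X => ntr (Em N * X)) h
  have e2 := congrArg (fun X => ntr (Em N * X)) h'
  have e3 := ntr_Em_mul_herm_mul_add Y G
  have c1 : ntr (Em N * G) = ntr (G * Em N) := ntr_mul_comm _ _
  have c2 : ntr (Em N * (G * Em N)) = ntr G := by
    rw [ntr_mul_comm, mul_assoc, Em_mul_Em, mul_one]
  have c3 : ntr (Em N * (Em N * G)) = ntr G := by
    rw [← mul_assoc, Em_mul_Em, one_mul]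
  simp only [Sop, mul_add, mul_sub, add_mul, sub_mul, Matrix.mul_smul, Matrix.smul_mul, mul_one,
    one_mul, ntr_add, ntr_sub, ntr_smul, mul_neg, ntr_neg, ntr_Em, c1, c2, c3] at e1 e2
  have : (2 * w) * ntr (G * Em N) = 0 := by linear_combination e1 + e2 + e3
  exact (mul_eq_zero.1 this).resolve_left (by simpa using hw)

lemma IsMDESolution.isDyson {Y : Matrix (Fin N) (Fin N) ℂ} {M : ℂ → Mat2 N} (hN : 0 < N)
    (h : IsMDESolution N Y M) {w : ℂ} (hw : w.im ≠ 0) : IsDyson (herm Y) w (M w) := by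
  obtain ⟨h1, h2⟩ := h w hw
  have hw0 : w ≠ 0 := fun h0 => hw (by simp [h0])
  have h0 := ntr_mul_Em_eq_zero hw0 h1
  refine ⟨?_, ?_⟩
  · rw [Sop, h0, zero_smul, sub_zero] at h1
    have e : herm Y - (w + ntr (M w)) • (1 : Mat2 N) =
        -(w • (1 : Mat2 N) - herm Y + ntr (M w) • (1 : Mat2 N)) := by
      rw [add_smul]; abel
    rw [e, mul_neg, h1, neg_neg]
  · have : Nonempty (Fin N) := ⟨⟨0, hN⟩⟩
    have ht := h2.trace_pos
    have hc : (0 : ℂ) < (Fintype.card (Idx N) : ℂ)⁻¹ := by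
      rw [inv_pos]
      exact_mod_cast Fintype.card_pos
    have hp : (0 : ℂ) < ntr ((w.im : ℝ) • matIm (M w)) := mul_pos hc ht
    have e : ntr ((w.im : ℝ) • matIm (M w)) = (((ntr (M w)).im * w.im : ℝ) : ℂ) := by
      have : (w.im : ℝ) • matIm (M w) = (w.im : ℂ) • matIm (M w) := by
        ext i j; simp
      rw [this, matIm, ntr_smul, ntr_smul, ntr_sub, ntr_conjTranspose, Complex.star_def,
        Complex.sub_conj]
      push_cast
      field_simp
    rw [e] at hp
    exact_mod_cast hp

/-- Mixed chirality traces of products of solutions vanish. -/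
lemma IsDyson.ntr_mul_mul_Em {Y : Matrix (Fin N) (Fin N) ℂ} {w₁ w₂ : ℂ} {G₁ G₂ : Mat2 N}
    (h₁ : IsDyson (herm Y) w₁ G₁) (h₂ : IsDyson (herm Y) w₂ G₂)
    (h0 : ntr (G₂ * Em N) = 0) : ntr (G₁ * G₂ * Em N) = 0 := by
  have comm : ∀ {w : ℂ} {G : Mat2 N}, IsDyson (herm Y) w G → herm Y * G = G * herm Y := by
    intro w G h
    have e := h.mul_eq_one'.trans h.mul_eq_one.symm
    simpa [sub_mul, mul_sub] using e
  have hc : herm Y * (G₁ * G₂) = G₁ * G₂ * herm Y := by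
    rw [← mul_assoc, comm h₁, mul_assoc, comm h₂, mul_assoc]
  have e1 := ntr_Em_mul_herm_mul_add Y (G₁ * G₂)
  rw [← hc] at e1
  have e2 : herm Y * (G₁ * G₂) = G₂ + (w₁ + ntr G₁) • (G₁ * G₂) := by
    have := congrArg (· * G₂) h₁.mul_eq_one'
    simp only [sub_mul, Matrix.smul_mul, one_mul] at this
    rw [← mul_assoc, ← sub_eq_iff_eq_add]
    exact this
  rw [e2, mul_add, ntr_add, Matrix.mul_smul, ntr_smul, ntr_mul_comm (Em N), h0,
    ntr_mul_comm (Em N)] at e1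
  have hu : w₁ + ntr G₁ ≠ 0 := by
    intro hu
    have := h₁.abs_im_add
    rw [hu, Complex.zero_im, abs_zero] at this
    linarith [h₁.abs_im_pos, h₁.abs_im_ntr_pos]
  have : (w₁ + ntr G₁) * ntr (G₁ * G₂ * Em N) = 0 := by linear_combination e1 / 2
  exact (mul_eq_zero.1 this).resolve_left hu

lemma EOf_one : EOf N 1 = 1 := by simp [EOf]

lemma EOf_neg_one : EOf N (-1) = Em N := by
  simp [EOf, show ¬ (0 : ℝ) < -1 by norm_num]

lemma opNorm_EOf_le (σ : ℝ) : opNorm (EOf N σ) ≤ 1 := by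
  unfold EOf
  split_ifs
  · exact opNorm_le_one_of_mem_unitary (one_mem _)
  · exact opNorm_Em_le

lemma hs_mul_EOf_le (X : Mat2 N) (σ : ℝ) : hs (X * EOf N σ) ≤ hs X := by
  have hE : (EOf N σ)ᴴ = EOf N σ := by
    unfold EOf
    split_ifs
    · simp
    · exact Em_conjTranspose
  rw [← hs_conjTranspose, Matrix.conjTranspose_mul, hE]
  refine (hs_mul_le _ _).trans ?_
  rw [hs_conjTranspose]
  exact mul_le_of_le_one_left (hs_nonneg _) (opNorm_EOf_le σ)

/-- Conjugation by `E_σ` maps solutions at `w` to solutions at `σ w`. -/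
lemma IsBulkDyson.conj_EOf {Y : Matrix (Fin N) (Fin N) ℂ} {w : ℂ} {G : Mat2 N} {q σ : ℝ}
    (h : IsBulkDyson q (herm Y) w G) (hσ : σ = 1 ∨ σ = -1) :
    IsBulkDyson q (herm Y) (σ * w) ((σ : ℂ) • (EOf N σ * G * EOf N σ)) := by
  rcases hσ with rfl | rfl
  · simpa [EOf_one] using h
  · have ht : ntr (Em N * G * Em N) = ntr G := by
      rw [ntr_mul_comm, ← mul_assoc, Em_mul_Em, one_mul]
    have e : ((-1 : ℝ) : ℂ) • (EOf N (-1) * G * EOf N (-1)) = -(Em N * G * Em N) := by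
      rw [EOf_neg_one]; simp
    rw [e]
    refine ⟨⟨?_, ?_⟩, ?_⟩
    · have e2 : herm Y - (((-1 : ℝ) : ℂ) * w + ntr (-(Em N * G * Em N))) • (1 : Mat2 N) =
          -(Em N * (herm Y - (w + ntr G) • (1 : Mat2 N)) * Em N) := by
        rw [ntr_neg, ht, mul_sub, sub_mul, Em_mul_herm, Matrix.mul_smul, Matrix.smul_mul, mul_one,
          neg_mul, mul_assoc, Em_mul_Em, mul_one]
        push_cast
        rw [show (-1 : ℂ) * w + -ntr G = -(w + ntr G) by ring, neg_smul]
        abel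
      rw [e2, neg_mul_neg]
      calc Em N * G * Em N * (Em N * (herm Y - (w + ntr G) • (1 : Mat2 N)) * Em N)
          = Em N * G * (Em N * Em N) * (herm Y - (w + ntr G) • (1 : Mat2 N)) * Em N := by
            noncomm_ring
        _ = Em N * (G * (herm Y - (w + ntr G) • (1 : Mat2 N))) * Em N := by
            rw [Em_mul_Em]; noncomm_ring
        _ = 1 := by rw [h.mul_eq_one, mul_one, Em_mul_Em]
    · rw [ntr_neg, ht]
      simpa using h.im_mul_pos
    · rw [ntr_neg, ht]
      simpa using h.le_abs_im

/-- Explicit inversion of `1 - S[M₁ · M₂]`. -/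
lemma exists_unique_inverse_stability {M₁ M₂ : Mat2 N} (h₁₂ : ntr (M₁ * M₂ * Em N) = 0)
    (h₂₁ : ntr (M₂ * M₁ * Em N) = 0) (hp : 1 - ntr (M₁ * M₂) ≠ 0)
    (hm : 1 + ntr (M₁ * Em N * M₂ * Em N) ≠ 0) (B : Mat2 N) :
    ∃ T : Mat2 N, T - Sop N (M₁ * T * M₂) = B ∧
      opNorm T ≤ opNorm B + ‖ntr (M₁ * B * M₂) / (1 - ntr (M₁ * M₂))‖ +
        ‖ntr (M₁ * B * M₂ * Em N) / (1 + ntr (M₁ * Em N * M₂ * Em N))‖ ∧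
      ∀ T' : Mat2 N, T' - Sop N (M₁ * T' * M₂) = B → T' = T := by
  have h₂₁' : ntr (M₁ * Em N * M₂) = 0 := by
    rw [mul_assoc, ntr_mul_comm, mul_assoc, ntr_mul_comm, ← h₂₁, mul_assoc, ntr_mul_comm]
  set α := ntr (M₁ * B * M₂) / (1 - ntr (M₁ * M₂)) with hα
  set β := -(ntr (M₁ * B * M₂ * Em N) / (1 + ntr (M₁ * Em N * M₂ * Em N))) with hβ
  have eα : α * (1 - ntr (M₁ * M₂)) = ntr (M₁ * B * M₂) := div_mul_cancel₀ _ hp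
  have eβ : β * (1 + ntr (M₁ * Em N * M₂ * Em N)) = -ntr (M₁ * B * M₂ * Em N) := by
    rw [hβ, neg_mul, div_mul_cancel₀ _ hm]
  have hT : B + α • (1 : Mat2 N) + β • Em N -
      Sop N (M₁ * (B + α • (1 : Mat2 N) + β • Em N) * M₂) = B := by
    have a : ntr (M₁ * (B + α • (1 : Mat2 N) + β • Em N) * M₂) = α := by
      simp only [mul_add, add_mul, Matrix.mul_smul, Matrix.smul_mul, mul_one, ntr_add, ntr_smul,
        h₂₁']
      linear_combination -eα
    have b : ntr (M₁ * (B + α • (1 : Mat2 N) + β • Em N) * M₂ * Em N) = -β := by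
      simp only [mul_add, add_mul, Matrix.mul_smul, Matrix.smul_mul, mul_one, ntr_add, ntr_smul,
        h₁₂]
      linear_combination eβ
    clear_value β
    rw [Sop, a, b, neg_smul, sub_neg_eq_add, add_assoc, add_sub_cancel_right]
  refine ⟨B + α • (1 : Mat2 N) + β • Em N, hT, ?_, fun T' hT' => ?_⟩
  · have n1 : opNorm (1 : Mat2 N) ≤ 1 := opNorm_le_one_of_mem_unitary (one_mem _)
    refine (opNorm_add_le _ _).trans (add_le_add ((opNorm_add_le _ _).trans ?_) ?_)
    · rw [opNorm_smul]
      gcongr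
      exact mul_le_of_le_one_right (norm_nonneg _) n1
    · rw [opNorm_smul, hβ, norm_neg]
      exact mul_le_of_le_one_right (norm_nonneg _) opNorm_Em_le
  · set T := B + α • (1 : Mat2 N) + β • Em N
    have hD : T' - T = Sop N (M₁ * (T' - T) * M₂) := by
      have e : Sop N (M₁ * (T' - T) * M₂) = Sop N (M₁ * T' * M₂) - Sop N (M₁ * T * M₂) := by
        simp only [Sop, mul_sub, sub_mul, ntr_sub, sub_smul]; abel
      rw [e, sub_eq_sub_iff_sub_eq_sub, hT', hT]
    set D := T' - T with hDdef
    have a := congrArg (fun X => ntr (M₁ * X * M₂)) hD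
    have b := congrArg (fun X => ntr (M₁ * X * M₂ * Em N)) hD
    simp only [Sop, mul_sub, sub_mul, Matrix.mul_smul, Matrix.smul_mul, mul_one, ntr_sub,
      ntr_smul, h₂₁', h₁₂] at a b
    have a0 : ntr (M₁ * D * M₂) = 0 := by
      refine (mul_eq_zero.1 (?_ : _ * (1 - ntr (M₁ * M₂)) = 0)).resolve_right hp
      linear_combination a
    have b0 : ntr (M₁ * D * M₂ * Em N) = 0 := by
      refine (mul_eq_zero.1 (?_ : _ * (1 + ntr (M₁ * Em N * M₂ * Em N)) = 0)).resolve_right hm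
      linear_combination b
    rw [Sop, a0, b0, zero_smul, zero_smul, sub_zero] at hD
    exact sub_eq_zero.1 hD

end Chirality

section CriticalDirection

variable {N : ℕ} {Y : Matrix (Fin N) (Fin N) ℂ} {w₁ w₂ : ℂ} {G₁ G₂ : Mat2 N} {q σ : ℝ}

lemma ntr_mul_smul_conj_EOf :
    ntr (G₁ * ((σ : ℂ) • (EOf N σ * G₂ * EOf N σ))) =
      σ * ntr (G₁ * EOf N σ * G₂ * EOf N σ) := by
  rw [Matrix.mul_smul, ntr_smul]
  simp only [mul_assoc]

lemma IsBulkDyson.one_sub_ntr_EOf_ne_zero (h₁ : IsBulkDyson q (herm Y) w₁ G₁)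
    (h₂ : IsBulkDyson q (herm Y) w₂ G₂) (hσ : σ = 1 ∨ σ = -1) :
    1 - σ * ntr (G₁ * EOf N σ * G₂ * EOf N σ) ≠ 0 := by
  rw [← ntr_mul_smul_conj_EOf]
  exact h₁.toIsDyson.one_sub_ntr_mul_ne_zero (h₂.conj_EOf hσ).toIsDyson
    (herm_conjTranspose Y)

lemma IsBulkDyson.le_norm_one_sub_EOf_of_pos (h₁ : IsBulkDyson q (herm Y) w₁ G₁)
    (h₂ : IsBulkDyson q (herm Y) w₂ G₂) (hq : 0 < q) (hq1 : q ≤ 1) (hσ : σ = 1 ∨ σ = -1)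
    (hw : 0 < σ * (w₁.im * w₂.im)) :
    q ^ 2 / 4 ≤ ‖1 - σ * ntr (G₁ * EOf N σ * G₂ * EOf N σ)‖ := by
  rw [← ntr_mul_smul_conj_EOf]
  refine h₁.le_norm_one_sub_of_im_mul_pos (h₂.conj_EOf hσ).toIsDyson (herm_conjTranspose Y)
    hq hq1 ?_
  rw [Complex.im_ofReal_mul]
  linarith

lemma IsBulkDyson.half_le_norm_ntr_EOf (h₁ : IsBulkDyson q (herm Y) w₁ G₁)
    (h₂ : IsBulkDyson q (herm Y) w₂ G₂) (hq : 0 < q) (hq1 : q ≤ 1) (hσ : σ = 1 ∨ σ = -1)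
    (hw : σ * (w₁.im * w₂.im) < 0) {δ : ℝ} (hδ : δ ≤ q ^ 3 / 26)
    (hre : |w₁.re - σ * w₂.re| ≤ δ) (him₁ : |w₁.im| ≤ δ) (him₂ : |w₂.im| ≤ δ) :
    1 / 2 ≤ ‖ntr (G₁ * EOf N σ * G₂ * EOf N σ)‖ := by
  have hσ1 : |σ| = 1 := by rcases hσ with rfl | rfl <;> simp
  have h₃ := (h₂.conj_EOf hσ).conjTranspose (herm_conjTranspose Y)
  have b := h₁.norm_one_sub_le_half h₃ (herm_conjTranspose Y) hq hq1
    (by simp only [Complex.star_def, Complex.conj_im, Complex.im_ofReal_mul]; linarith) hδ him₁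
    (by
      refine (Complex.norm_le_abs_re_add_abs_im _).trans ?_
      simp only [Complex.sub_re, Complex.sub_im, Complex.star_def, Complex.conj_im,
        Complex.conj_re, Complex.im_ofReal_mul, Complex.re_ofReal_mul]
      have : |w₁.im - -(σ * w₂.im)| ≤ |w₁.im| + |w₂.im| := by
        rw [sub_neg_eq_add]
        refine (abs_add_le _ _).trans ?_
        rw [abs_mul, hσ1, one_mul]
      linarith)
  rw [Matrix.conjTranspose_conjTranspose, ntr_mul_smul_conj_EOf] at b
  have c := norm_sub_norm_le (1 : ℂ) (σ * ntr (G₁ * EOf N σ * G₂ * EOf N σ))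
  rw [norm_one, norm_mul, Complex.norm_real, Real.norm_eq_abs, hσ1, one_mul] at c
  linarith

lemma IsBulkDyson.le_norm_one_sub_EOf_of_neg (h₁ : IsBulkDyson q (herm Y) w₁ G₁)
    (h₂ : IsBulkDyson q (herm Y) w₂ G₂) (hq : 0 < q) (hq1 : q ≤ 1) (hσ : σ = 1 ∨ σ = -1)
    {x : ℝ} (hx : 0 < x) (hx1 : x ≤ 1)
    (hfar : x ≤ |w₁.im| ∨ x ≤ |w₂.im| ∨ x ≤ |w₁.re - σ * w₂.re|) :
    x ^ 2 * q ^ 2 / 72 ≤ ‖1 - σ * ntr (G₁ * EOf N σ * G₂ * EOf N σ)‖ := by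
  have hσ1 : |σ| = 1 := by rcases hσ with rfl | rfl <;> simp
  have h₃ := (h₂.conj_EOf hσ).conjTranspose (herm_conjTranspose Y)
  have b := h₁.le_norm_one_sub_conjTranspose h₃.toIsDyson (herm_conjTranspose Y) hq hq1 hx hx1
    (by
      refine hfar.imp_right (Or.imp (fun h => ?_) fun h => h.trans ?_)
      · simpa [abs_mul, hσ1] using h
      · refine le_trans (le_of_eq ?_) (Complex.abs_re_le_norm _)
        simp)
  rwa [Matrix.conjTranspose_conjTranspose, ntr_mul_smul_conj_EOf] at b

lemma norm_ntr_mul_mul_mul_EOf_le (h₁ : hs G₁ ≤ 1) (h₂ : hs G₂ ≤ 1) (A : Mat2 N) (τ : ℝ) :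
    ‖ntr (G₁ * A * G₂ * EOf N τ)‖ ≤ opNorm A := by
  have hA : 0 ≤ opNorm A := norm_nonneg _
  calc ‖ntr (G₁ * A * G₂ * EOf N τ)‖ = ‖ntr (G₁ * (A * (G₂ * EOf N τ)))‖ := by
        simp only [mul_assoc]
    _ ≤ hs G₁ * hs (A * (G₂ * EOf N τ)) := norm_ntr_mul_le _ _
    _ ≤ 1 * (opNorm A * 1) := by
        gcongr
        · exact hs_nonneg _
        · refine (hs_mul_le _ _).trans ?_
          gcongr
          exact (hs_mul_EOf_le _ _).trans h₂
    _ = opNorm A := by ring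

end CriticalDirection

section Cutoff

variable {δ σ : ℝ} {φ : ℝ → ℝ} {w₁ w₂ : ℂ}

lemma IsBump.abs_lt (h : IsBump δ φ) {x : ℝ} (hx : φ x ≠ 0) : |x| < δ := by
  by_contra! hc
  exact hx (h.eq_zero x hc)

lemma IsBump.close_of_cutoff_ne_zero (h : IsBump δ φ) (hc : cutoff φ σ w₁ w₂ ≠ 0) :
    |w₁.re - σ * w₂.re| < δ ∧ |w₁.im| < δ ∧ |w₂.im| < δ := by
  simp only [cutoff, mul_ne_zero_iff] at hc
  exact ⟨h.abs_lt hc.1.1, h.abs_lt hc.1.2, h.abs_lt hc.2⟩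

lemma IsBump.far_of_cutoff_ne_one (h : IsBump δ φ) (hc : cutoff φ σ w₁ w₂ ≠ 1) :
    δ / 2 ≤ |w₁.im| ∨ δ / 2 ≤ |w₂.im| ∨ δ / 2 ≤ |w₁.re - σ * w₂.re| := by
  by_contra! hf
  apply hc
  rw [cutoff, h.eq_one _ hf.1.le, h.eq_one _ hf.2.1.le, h.eq_one _ hf.2.2.le]
  norm_num

lemma IsBump.cutoff_nonneg (h : IsBump δ φ) : 0 ≤ cutoff φ σ w₁ w₂ :=
  mul_nonneg (mul_nonneg (h.nonneg _) (h.nonneg _)) (h.nonneg _)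

lemma IsBump.cutoff_le_one (h : IsBump δ φ) : cutoff φ σ w₁ w₂ ≤ 1 :=
  mul_le_one₀ (mul_le_one₀ (h.le_one _) (h.nonneg _) (h.le_one _)) (h.nonneg _) (h.le_one _)

end Cutoff

lemma neg_rsgn_eq {x : ℝ} (hx : x ≠ 0) :
    (-rsgn x = 1 ∨ -rsgn x = -1) ∧ -rsgn x * x < 0 := by
  unfold rsgn
  rcases lt_or_gt_of_ne hx with h | h
  · simp [h, h.not_gt]
  · simp [h]

/-- Solutions above bulk points are macroscopically away from the real axis. -/
lemma IsMDESolution.isBulkDyson {N : ℕ} {Y : Matrix (Fin N) (Fin N) ℂ} {M : ℂ → Mat2 N}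
    (hN : 0 < N) (hM : IsMDESolution N Y M) {w b : ℂ} {r : ℝ} (hw : w.im ≠ 0)
    (hr : 0 < r) (hr1 : r ≤ 1)
    (hb : Tendsto (fun η : ℝ => ntr (M ((w.re : ℂ) + (η : ℂ) * Complex.I))) (𝓝[>] 0) (𝓝 b))
    (hrb : r ≤ b.im) : IsBulkDyson (r ^ 3 / 8) (herm Y) w (M w) := by
  have hH := herm_conjTranspose Y
  have hF : ∀ η : ℝ, 0 < η → IsDyson (herm Y) ((w.re : ℂ) + (η : ℂ) * Complex.I)
      (M ((w.re : ℂ) + (η : ℂ) * Complex.I)) := fun η hη =>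
    hM.isDyson hN (by simpa using hη.ne')
  rcases lt_or_gt_of_ne hw with h | h
  · have h' := (hM.isDyson hN hw).conjTranspose hH
    have := isBulkDyson_of_tendsto (w := star w) hH h' (by simpa using h) hr hr1
      (F := fun η : ℝ => M ((w.re : ℂ) + (η : ℂ) * Complex.I)) (by simpa using hF) hb hrb
    simpa using this.conjTranspose hH
  · exact isBulkDyson_of_tendsto hH (hM.isDyson hN hw) h hr hr1 hF hb hrb

/-- The regular component is bounded and the inverse stability operator is bounded on it. -/
lemma IsBulkDyson.exists_unique_bounded_inverse {N : ℕ} {Y : Matrix (Fin N) (Fin N) ℂ}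
    {w₁ w₂ : ℂ} {M₁ M₂ : Mat2 N} {q s δ CA : ℝ} {φ : ℝ → ℝ}
    (h₁ : IsBulkDyson q (herm Y) w₁ M₁) (h₂ : IsBulkDyson q (herm Y) w₂ M₂)
    (h₁0 : ntr (M₁ * Em N) = 0) (h₂0 : ntr (M₂ * Em N) = 0)
    (hq : 0 < q) (hq1 : q ≤ 1) (hs : s = 1 ∨ s = -1) (hw : s * (w₁.im * w₂.im) < 0)
    (hδ : 0 < δ) (hδ1 : δ ≤ q ^ 3 / 26) (hφ : IsBump δ φ) {A : Mat2 N} (hA : opNorm A ≤ CA)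
    {B : Mat2 N}
    (hB : B = A - ((cutoff φ s w₁ w₂ : ℂ) *
      (ntr (M₁ * A * M₂ * EOf N s) / ntr (M₁ * EOf N s * M₂ * EOf N s))) • EOf N s) :
    ∃ T : Mat2 N, T - Sop N (M₁ * T * M₂) = B ∧
      opNorm T ≤ 3 * CA + 2 * (3 * CA / ((δ / 2) ^ 2 * q ^ 2 / 72)) ∧
      ∀ T' : Mat2 N, T' - Sop N (M₁ * T' * M₂) = B → T' = T := by
  have hH := herm_conjTranspose Y
  have hs1 := h₁.toIsDyson.hs_le_one hH
  have hs2 := h₂.toIsDyson.hs_le_one hH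
  have hCA : 0 ≤ CA := (norm_nonneg _).trans hA
  set P := ntr (M₁ * EOf N s * M₂ * EOf N s) with hP
  set c := cutoff φ s w₁ w₂ with hc
  set k := (δ / 2) ^ 2 * q ^ 2 / 72 with hk
  have hk0 : 0 < k := by positivity
  have hx1 : δ / 2 ≤ 1 := by
    have : q ^ 3 ≤ 1 := pow_le_one₀ hq.le hq1
    linarith
  have hP2 : c ≠ 0 → 1 / 2 ≤ ‖P‖ := fun h0 => by
    obtain ⟨a1, a2, a3⟩ := hφ.close_of_cutoff_ne_zero h0
    exact h₁.half_le_norm_ntr_EOf h₂ hq hq1 hs hw hδ1 a1.le a2.le a3.le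
  have hBn : opNorm B ≤ 3 * CA := by
    have hcoef : ‖(c : ℂ) * (ntr (M₁ * A * M₂ * EOf N s) / P)‖ ≤ 2 * CA := by
      by_cases h0 : c = 0
      · simp [h0, hCA]
      · have hp := hP2 h0
        have hnum := (norm_ntr_mul_mul_mul_EOf_le hs1 hs2 A s).trans hA
        rw [norm_mul, norm_div, Complex.norm_real, Real.norm_of_nonneg hφ.cutoff_nonneg]
        calc c * (‖ntr (M₁ * A * M₂ * EOf N s)‖ / ‖P‖) ≤ 1 * (CA / (1 / 2)) := by
              gcongr
              exact hφ.cutoff_le_one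
          _ = 2 * CA := by ring
    rw [hB, sub_eq_add_neg, ← neg_smul]
    refine (opNorm_add_le _ _).trans ?_
    rw [opNorm_smul, norm_neg]
    have := mul_le_of_le_one_right (norm_nonneg ((c : ℂ) *
      (ntr (M₁ * A * M₂ * EOf N s) / P))) (opNorm_EOf_le (N := N) s)
    linarith
  have bound : ∀ τ : ℝ, τ = 1 ∨ τ = -1 →
      ‖ntr (M₁ * B * M₂ * EOf N τ) / (1 - τ * ntr (M₁ * EOf N τ * M₂ * EOf N τ))‖ ≤
        3 * CA / k := by
    intro τ hτ
    have hnum := (norm_ntr_mul_mul_mul_EOf_le hs1 hs2 B τ).trans hBn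
    have main : k ≤ ‖1 - τ * ntr (M₁ * EOf N τ * M₂ * EOf N τ)‖ →
        ‖ntr (M₁ * B * M₂ * EOf N τ) / (1 - τ * ntr (M₁ * EOf N τ * M₂ * EOf N τ))‖ ≤
          3 * CA / k := fun h => by
      rw [norm_div]; gcongr
    by_cases hτs : τ = s
    · subst hτs
      by_cases h1 : c = 1
      · have hP0 : P ≠ 0 := fun h0 => by
          have := hP2 (by rw [h1]; exact one_ne_zero)
          rw [h0, norm_zero] at this
          norm_num at this
        have : ntr (M₁ * B * M₂ * EOf N τ) = 0 := by
          rw [hB, h1]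
          simp only [mul_sub, sub_mul, Matrix.mul_smul, Matrix.smul_mul, ntr_sub, ntr_smul, ← hP]
          field_simp
          push_cast
          ring
        rw [this, zero_div, norm_zero]
        positivity
      · exact main (h₁.le_norm_one_sub_EOf_of_neg h₂ hq hq1 hτ (by positivity) hx1
          (hφ.far_of_cutoff_ne_one h1))
    · have hτ' : τ = -s := by
        rcases hτ with rfl | rfl <;> rcases hs with rfl | rfl <;> simp_all
      refine main (le_trans ?_ (h₁.le_norm_one_sub_EOf_of_pos h₂ hq hq1 hτ ?_))
      · have : (δ / 2) ^ 2 ≤ 1 := pow_le_one₀ (by positivity) hx1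
        rw [hk]
        nlinarith [sq_nonneg q]
      · rw [hτ']; linarith
  have n1 := h₁.one_sub_ntr_EOf_ne_zero h₂ (Or.inl rfl : (1 : ℝ) = 1 ∨ (1 : ℝ) = -1)
  have n2 := h₁.one_sub_ntr_EOf_ne_zero h₂ (Or.inr rfl : (-1 : ℝ) = 1 ∨ (-1 : ℝ) = -1)
  have b1 := bound 1 (Or.inl rfl)
  have b2 := bound (-1) (Or.inr rfl)
  simp only [EOf_one, EOf_neg_one, mul_one, Complex.ofReal_one, Complex.ofReal_neg, one_mul,
    neg_one_mul, sub_neg_eq_add] at n1 n2 b1 b2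
  obtain ⟨T, hT, hTn, hTu⟩ := exists_unique_inverse_stability
    (h₁.toIsDyson.ntr_mul_mul_Em h₂.toIsDyson h₂0)
    (h₂.toIsDyson.ntr_mul_mul_Em h₁.toIsDyson h₁0) n1 n2 B
  exact ⟨T, hT, by linarith, hTu⟩

/-- **Normalisation of the critical eigenvectors and boundedness of the inverse
stability operator on regular observables** (Appendix B):
(a) if `1_δ^s(w₁,w₂) = 1` then the critical eigentriple of `B₁₂ = 1 − M₁S[·]M₂`
satisfies `⟨L,R⟩ ∼ 1`, and whenever `1_δ^±(w₁,w₂) = 1` the corresponding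
denominator in the regularisation is bounded away from zero;
(b) `X₁₂[B] = (1 − S[M₁·B·M₂])⁻¹[B]` is well defined and bounded on the
`s`-regular component `Åˢ` of any bounded `A`. -/
theorem critical_eigenvector_normalisation_and_bounded_inverse
    (Λ : (N : ℕ) → Matrix (Fin N) (Fin N) ℂ)
    (CΛ : ℝ) (hΛ : ∀ N, opNorm (Λ N) ≤ CΛ)
    (κ : ℝ) (hκ : 0 < κ)
    (M : (N : ℕ) → ℂ → Mat2 N) (hM : ∀ N, IsMDESolution N (Λ N) (M N))
    (mB : (N : ℕ) → ℝ → ℂ)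
    (hmB : ∀ (N : ℕ) (e : ℝ),
      Tendsto (fun η : ℝ => ntr (M N ((e : ℂ) + (η : ℂ) * Complex.I)))
        (nhdsWithin 0 (Set.Ioi 0)) (nhds (mB N e)))
    (ρ : (N : ℕ) → ℝ → ℝ) (hρ : ∀ N e, ρ N e = (mB N e).im / Real.pi) :
    ∃ δ₀ : ℝ, 0 < δ₀ ∧ ∀ δ : ℝ, 0 < δ → δ ≤ δ₀ → ∀ φ : ℝ → ℝ, IsBump δ φ →
      -- (a) normalisation ⟨L,R⟩ ∼ 1 and nonvanishing denominators
      (∃ c C : ℝ, 0 < c ∧ 0 < C ∧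
        ∀ (N : ℕ) (w₁ w₂ : ℂ), w₁.im ≠ 0 → w₂.im ≠ 0 →
          κ ^ ((1 : ℝ)/3) ≤ ρ N w₁.re → κ ^ ((1 : ℝ)/3) ≤ ρ N w₂.re →
          (cutoff φ (-rsgn (w₁.im * w₂.im)) w₁ w₂ = 1 →
            c ≤ ‖ntr (EOf N (-rsgn (w₁.im * w₂.im)) *
                  (M N w₁ * EOf N (-rsgn (w₁.im * w₂.im)) * M N w₂))‖ ∧
            ‖ntr (EOf N (-rsgn (w₁.im * w₂.im)) *
                  (M N w₁ * EOf N (-rsgn (w₁.im * w₂.im)) * M N w₂))‖ ≤ C) ∧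
          (∀ σ : ℝ, σ = 1 ∨ σ = -1 → cutoff φ σ w₁ w₂ = 1 →
            c ≤ ‖ntr (M N w₁ * EOf N σ *
                  M N ((w₂.re : ℂ) +
                    ((σ * (-rsgn (w₁.im * w₂.im)) * w₂.im : ℝ) : ℂ) * Complex.I) *
                  EOf N σ)‖)) ∧
      -- (b) bounded well-defined inverse of 1 − S[M₁·M₂] on Åˢ
      (∀ CA : ℝ, ∃ C : ℝ, 0 < C ∧
        ∀ (N : ℕ) (w₁ w₂ : ℂ), w₁.im ≠ 0 → w₂.im ≠ 0 →
          κ ^ ((1 : ℝ)/3) ≤ ρ N w₁.re → κ ^ ((1 : ℝ)/3) ≤ ρ N w₂.re →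
          ∀ A : Mat2 N, opNorm A ≤ CA →
            ∃ T : Mat2 N,
              (T - Sop N (M N w₁ * T * M N w₂) =
                A - (((cutoff φ (-rsgn (w₁.im * w₂.im)) w₁ w₂ : ℝ) : ℂ) *
                    (ntr (M N w₁ * A * M N w₂ * EOf N (-rsgn (w₁.im * w₂.im))) /
                      ntr (M N w₁ * EOf N (-rsgn (w₁.im * w₂.im)) * M N w₂ *
                        EOf N (-rsgn (w₁.im * w₂.im))))) •
                  EOf N (-rsgn (w₁.im * w₂.im))) ∧
              opNorm T ≤ C ∧
              (∀ T' : Mat2 N,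
                T' - Sop N (M N w₁ * T' * M N w₂) =
                  A - (((cutoff φ (-rsgn (w₁.im * w₂.im)) w₁ w₂ : ℝ) : ℂ) *
                      (ntr (M N w₁ * A * M N w₂ * EOf N (-rsgn (w₁.im * w₂.im))) /
                        ntr (M N w₁ * EOf N (-rsgn (w₁.im * w₂.im)) * M N w₂ *
                          EOf N (-rsgn (w₁.im * w₂.im))))) •
                    EOf N (-rsgn (w₁.im * w₂.im)) → T' = T)) := by
  have hκ3 : 0 < κ ^ ((1 : ℝ) / 3) := Real.rpow_pos_of_pos hκ _
  set r : ℝ := min (Real.pi * κ ^ ((1 : ℝ) / 3)) 1 with hr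
  have hr0 : 0 < r := lt_min (mul_pos Real.pi_pos hκ3) one_pos
  have hr1 : r ≤ 1 := min_le_right _ _
  set q : ℝ := r ^ 3 / 8 with hq
  have hq0 : 0 < q := by positivity
  have hq1 : q ≤ 1 := by
    have : r ^ 3 ≤ 1 := pow_le_one₀ hr0.le hr1
    linarith
  have hpos : ∀ (N : ℕ) (e : ℝ), κ ^ ((1 : ℝ) / 3) ≤ ρ N e → 0 < N ∧ r ≤ (mB N e).im := by
    intro N e he
    rw [hρ, le_div_iff₀ Real.pi_pos] at he
    have hre : r ≤ (mB N e).im := (min_le_left _ _).trans (by linarith)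
    refine ⟨Nat.pos_of_ne_zero fun hN => ?_, hre⟩
    subst hN
    have h0 : mB 0 e = 0 := tendsto_nhds_unique (hmB 0 e) (by simp [ntr])
    rw [h0, Complex.zero_im] at hre
    linarith
  have bulk : ∀ (N : ℕ) (w : ℂ), w.im ≠ 0 → κ ^ ((1 : ℝ) / 3) ≤ ρ N w.re →
      IsBulkDyson q (herm (Λ N)) w (M N w) := fun N w hw he =>
    (hM N).isBulkDyson (hpos N _ he).1 hw hr0 hr1 (hmB N w.re) (hpos N _ he).2
  refine ⟨q ^ 3 / 26, by positivity, fun δ hδ hδ1 φ hφ => ⟨?_, fun CA => ?_⟩⟩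
  · refine ⟨1 / 2, 1, by norm_num, one_pos, fun N w₁ w₂ hw₁ hw₂ he₁ he₂ => ?_⟩
    have h₁ := bulk N w₁ hw₁ he₁
    have h₂ := bulk N w₂ hw₂ he₂
    obtain ⟨hs, hneg⟩ := neg_rsgn_eq (mul_ne_zero hw₁ hw₂)
    set s := -rsgn (w₁.im * w₂.im) with hsdef
    refine ⟨fun hc => ?_, fun σ hσ hc => ?_⟩
    · obtain ⟨a1, a2, a3⟩ := hφ.close_of_cutoff_ne_zero (hc.trans_ne one_ne_zero)
      rw [ntr_mul_comm]
      refine ⟨h₁.half_le_norm_ntr_EOf h₂ hq0 hq1 hs hneg hδ1 a1.le a2.le a3.le, ?_⟩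
      refine (norm_ntr_mul_mul_mul_EOf_le (h₁.toIsDyson.hs_le_one (herm_conjTranspose _))
        (h₂.toIsDyson.hs_le_one (herm_conjTranspose _)) _ _).trans (opNorm_EOf_le s)
    · obtain ⟨a1, a2, a3⟩ := hφ.close_of_cutoff_ne_zero (hc.trans_ne one_ne_zero)
      have abs1 : ∀ t : ℝ, t = 1 ∨ t = -1 → |t| = 1 := by
        rintro t (rfl | rfl) <;> simp
      have sq1 : σ * σ = 1 := by rcases hσ with rfl | rfl <;> norm_num
      set v : ℂ := (w₂.re : ℂ) + ((σ * s * w₂.im : ℝ) : ℂ) * Complex.I with hv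
      have hvre : v.re = w₂.re := by simp [hv]
      have hvim : v.im = σ * s * w₂.im := by simp [hv]
      have hvabs : |v.im| = |w₂.im| := by
        rw [hvim, abs_mul, abs_mul, abs1 σ hσ, abs1 s hs, one_mul, one_mul]
      have h₃ := bulk N v (abs_ne_zero.1 (by rw [hvabs]; exact abs_ne_zero.2 hw₂))
        (by rwa [hvre])
      refine h₁.half_le_norm_ntr_EOf h₃ hq0 hq1 hσ ?_ hδ1 (by rw [hvre]; exact a1.le) a2.le
        (by rw [hvabs]; exact a3.le)
      have : σ * (w₁.im * v.im) = σ * σ * (s * (w₁.im * w₂.im)) := by rw [hvim]; ring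
      rw [this, sq1, one_mul]
      exact hneg
  · refine ⟨3 * (|CA| + 1) + 2 * (3 * (|CA| + 1) / ((δ / 2) ^ 2 * q ^ 2 / 72)), by positivity,
      fun N w₁ w₂ hw₁ hw₂ he₁ he₂ A hA => ?_⟩
    have h0 : ∀ w : ℂ, w.im ≠ 0 → ntr (M N w * Em N) = 0 := fun w hw =>
      ntr_mul_Em_eq_zero (fun h => hw (by simp [h])) (hM N w hw).1
    obtain ⟨hs, hneg⟩ := neg_rsgn_eq (mul_ne_zero hw₁ hw₂)
    exact (bulk N w₁ hw₁ he₁).exists_unique_bounded_inverse (bulk N w₂ hw₂ he₂)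
      (h0 w₁ hw₁) (h0 w₂ hw₂) hq0 hq1 hs hneg hδ hδ1 hφ
      (hA.trans ((le_abs_self CA).trans (by linarith))) rfl
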